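/- Let K ⊆ ℝⁿ be a convex body such that every boundary point of K is an endpoint of a diameter segment of K (a segment [x,y] ⊆ K with ‖x−y‖ = diam K). Then K is a body of constant width diam K. -/

import Mathlib

open scoped RealInnerProductSpace
open Metric

noncomputable def supp {n : ℕ} (K : Set (EuclideanSpace ℝ (Fin n)))
    (u : EuclideanSpace ℝ (Fin n)) : ℝ :=
  sSup ((fun x => ⟪x, u⟫) '' K)

theorem mem_of_dist_le {n : ℕ} [Nontrivial (EuclideanSpace ℝ (Fin n))]
    (K : Set (EuclideanSpace ℝ (Fin n)))
    (hKc : IsCompact K) (hKint : (interior K).Nonempty)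
    (hdiam : ∀ x ∈ frontier K, ∃ y ∈ K, ‖x - y‖ = Metric.diam K)
    (z : EuclideanSpace ℝ (Fin n)) (hz : ∀ y ∈ K, ‖z - y‖ ≤ Metric.diam K) : z ∈ K := by
  by_contra hzK
  obtain ⟨p, hp⟩ := hKint
  obtain ⟨x, hxs, hxf⟩ : (segment ℝ p z ∩ frontier K).Nonempty := by
    by_contra hemp
    have hcov : segment ℝ p z ⊆ interior K ∪ Kᶜ := by
      intro w hw
      by_cases hwK : w ∈ K
      · left
        by_contra hwi
        exact hemp ⟨w, hw, subset_closure hwK, hwi⟩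
      · exact Or.inr hwK
    obtain ⟨w, -, hw1, hw2⟩ := (convex_segment p z).isPreconnected _ _ isOpen_interior
      hKc.isClosed.isOpen_compl hcov ⟨p, left_mem_segment ℝ p z, hp⟩
      ⟨z, right_mem_segment ℝ p z, hzK⟩
    exact hw2 (interior_subset hw1)
  obtain ⟨y, hy, hxy⟩ := hdiam x hxf
  have hsub : K ⊆ closedBall y (Metric.diam K) := fun w hw =>
    mem_closedBall.2 (Metric.dist_le_diam_of_mem hKc.isBounded hw hy)
  have hp' := interior_mono hsub hp
  have hz' : z ∈ closedBall y (Metric.diam K) := by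
    rw [mem_closedBall, dist_eq_norm]; exact hz y hy
  have hxz : x ≠ z := fun h => hzK (h ▸ hKc.isClosed.frontier_subset hxf)
  have hxp : x ≠ p := fun h => hxf.2 (h ▸ hp)
  have hxo : x ∈ openSegment ℝ p z := mem_openSegment_of_ne_left_right hxp.symm hxz.symm hxs
  have := (convex_closedBall y (Metric.diam K)).openSegment_interior_self_subset_interior hp' hz' hxo
  rw [interior_closedBall', mem_ball, dist_eq_norm] at this
  linarith

theorem diameter_endpoints_constant_width {n : ℕ} (K : Set (EuclideanSpace ℝ (Fin n)))
    (hKc : IsCompact K) (hKconv : Convex ℝ K) (hKint : (interior K).Nonempty)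
    (hdiam : ∀ x ∈ frontier K, ∃ y ∈ K, ‖x - y‖ = Metric.diam K) :
    ∀ u : EuclideanSpace ℝ (Fin n), ‖u‖ = 1 →
      supp K u + supp K (-u) = Metric.diam K := by
  intro u hu
  have hnt : Nontrivial (EuclideanSpace ℝ (Fin n)) :=
    ⟨u, 0, fun h => by simp [h] at hu⟩
  have hmem := mem_of_dist_le K hKc hKint hdiam
  set d := Metric.diam K with hd
  have hd0 : 0 ≤ d := Metric.diam_nonneg
  have hdist : ∀ a ∈ K, ∀ b ∈ K, ‖a - b‖ ≤ d := fun a ha b hb => by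
    rw [← dist_eq_norm]; exact Metric.dist_le_diam_of_mem hKc.isBounded ha hb
  have hne : K.Nonempty := hKint.mono interior_subset
  have hbdd : ∀ v : EuclideanSpace ℝ (Fin n), BddAbove ((fun x => ⟪x, v⟫) '' K) := fun v =>
    (hKc.image (by fun_prop)).bddAbove
  have huu : ⟪u, u⟫ = 1 := by rw [real_inner_self_eq_norm_sq, hu]; norm_num
  obtain ⟨x, hx, hxmax⟩ := hKc.exists_isMaxOn hne
    (f := fun x => ⟪x, u⟫) (by fun_prop)
  have hmax : ∀ w ∈ K, ⟪w, u⟫ ≤ ⟪x, u⟫ := fun w hw => hxmax hw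
  apply le_antisymm
  · obtain ⟨x', hx', hxmax'⟩ := hKc.exists_isMaxOn hne
      (f := fun x => ⟪x, -u⟫) (by fun_prop)
    have h1 : supp K u ≤ ⟪x, u⟫ := csSup_le (hne.image _) (by
      rintro _ ⟨w, hw, rfl⟩; exact hmax w hw)
    have h2 : supp K (-u) ≤ ⟪x', -u⟫ := csSup_le (hne.image _) (by
      rintro _ ⟨w, hw, rfl⟩; exact hxmax' hw)
    have h3 : ⟪x - x', u⟫ ≤ ‖x - x'‖ * ‖u‖ := real_inner_le_norm _ _
    rw [inner_sub_left, hu] at h3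
    rw [inner_neg_right] at h2
    have := hdist x hx x' hx'
    linarith
  · have key : x - d • u ∈ K := by
      apply hmem
      intro w hw
      by_contra hcon
      push Not at hcon
      -- z is w relative to x
      obtain ⟨z, rfl⟩ : ∃ z, w = x + z := ⟨w - x, by abel⟩
      have hs : ⟪z, u⟫ ≤ 0 := by
        have := hmax _ hw
        rw [inner_add_left] at this; linarith
      have hlt : 0 < ‖z‖ ^ 2 + 2 * d * ⟪z, u⟫ := by
        have e : x - d • u - (x + z) = -(z + d • u) := by abel
        rw [e, norm_neg] at hcon
        have h1 : d ^ 2 < ‖z + d • u‖ ^ 2 := by gcongr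
        rw [norm_add_sq_real, inner_smul_right, norm_smul, hu, mul_one, Real.norm_eq_abs,
          sq_abs] at h1
        linarith
      obtain ⟨b, hb0, hbs, hbd⟩ : ∃ b : ℝ, 0 ≤ b ∧ 0 < ⟪z, u⟫ + b ∧ 2 * (b * d) < ‖z‖ ^ 2 := by
        set η := (‖z‖ ^ 2 + 2 * d * ⟪z, u⟫) / (4 * (d + 1)) with hη
        have hη0 : 0 < η := by positivity
        have hη1 : η * (4 * (d + 1)) = ‖z‖ ^ 2 + 2 * d * ⟪z, u⟫ := by
          rw [hη]; field_simp
        refine ⟨-⟪z, u⟫ + η, by linarith, by linarith, ?_⟩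
        nlinarith [mul_nonneg hη0.le hd0]
      set v := z + b • u with hv
      set δ := ‖z‖ ^ 2 - 2 * (b * d) with hδ
      have hδ0 : 0 < δ := by linarith
      set ε := min 1 (δ / (‖v‖ ^ 2 + 1)) with hε
      have hε0 : 0 < ε := lt_min one_pos (by positivity)
      have hε1 : ε ≤ 1 := min_le_left _ _
      have hε2 : ε * ‖v‖ ^ 2 ≤ δ := by
        have h : ε ≤ δ / (‖v‖ ^ 2 + 1) := min_le_right _ _
        rw [le_div_iff₀ (by positivity)] at h
        linarith
      have hK : x + ε • v ∈ K := by
        apply hmem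
        intro y hy
        obtain ⟨c, rfl⟩ : ∃ c, y = x + c := ⟨y - x, by abel⟩
        have hc : ‖c‖ ≤ d := by simpa using hdist _ hy _ hx
        have hzc : ‖z - c‖ ≤ d := by
          have := hdist _ hw _ hy
          rwa [add_sub_add_left_eq_sub] at this
        have hc2 : ‖c‖ ^ 2 ≤ d ^ 2 := by gcongr
        have hzc2 : ‖z - c‖ ^ 2 ≤ d ^ 2 := by gcongr
        rw [norm_sub_sq_real] at hzc2
        have huc : -d ≤ ⟪u, c⟫ := by
          have := (abs_le.1 (abs_real_inner_le_norm u c)).1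
          rw [hu] at this; linarith
        have hvc : ⟪v, c⟫ = ⟪z, c⟫ + b * ⟪u, c⟫ := by
          rw [hv, inner_add_left, real_inner_smul_left]
        have hbuc : b * -d ≤ b * ⟪u, c⟫ := by gcongr
        have h2 : δ - (d ^ 2 - ‖c‖ ^ 2) ≤ 2 * ⟪v, c⟫ := by
          rw [hvc]; linarith
        rw [add_sub_add_left_eq_sub]
        refine (sq_le_sq₀ (norm_nonneg _) hd0).1 ?_
        rw [norm_sub_sq_real, real_inner_smul_left, norm_smul, Real.norm_eq_abs, mul_pow, sq_abs]
        have h3 := mul_le_mul_of_nonneg_left h2 hε0.le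
        have h4 := mul_le_mul_of_nonneg_left hε2 hε0.le
        have h5 := mul_nonneg (sub_nonneg.2 hε1) (sub_nonneg.2 hc2)
        nlinarith
      have h1 := hmax _ hK
      have h2 : ⟪v, u⟫ = ⟪z, u⟫ + b := by
        rw [hv, inner_add_left, real_inner_smul_left, huu, mul_one]
      rw [inner_add_left, real_inner_smul_left, h2] at h1
      have := mul_pos hε0 hbs
      linarith
    have h1 : ⟪x, u⟫ ≤ supp K u := le_csSup (hbdd u) ⟨x, hx, rfl⟩
    have h2 : ⟪x - d • u, -u⟫ ≤ supp K (-u) := le_csSup (hbdd (-u)) ⟨_, key, rfl⟩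
    rw [inner_neg_right, inner_sub_left, real_inner_smul_left, huu] at h2
    linarith
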